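/- arXiv:1108.0458 — 2 statements merged into one kernel-verified Lean document; each statement's English description precedes it below -/
import Mathlib

section
/- There exists c ∈ 𝕂 such that c is nonzero and for all 1 ≤ i ≤ d one has φ_i = a^{−1}b^{−1}q^{d+1}(q^i − q^{−i})(q^{i−d−1} − q^{d−i+1})(q^{−i} − abc·q^{i−d−1})(q^{−i} − abc^{−1}·q^{i−d−1}) and ϕ_i = a·b^{−1}q^{d+1}(q^i − q^{−i})(q^{i−d−1} − q^{d−i+1})(q^{−i} − a^{−1}bc·q^{i−d−1})(q^{−i} − a^{−1}bc^{−1}·q^{i−d−1}). Moreover, if c satisfies these conditions then so does c^{−1}, and any c′ ∈ 𝕂 satisfying these conditions equals c or c^{−1}. -/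
/-- θ_i = a·q^{2i−d} + a^{−1}·q^{d−2i}. -/
noncomputable def qθ {K : Type*} [Field K] (d : ℕ) (a q : K) (i : ℕ) : K :=
  a * q ^ (2 * (i : ℤ) - (d : ℤ)) + a⁻¹ * q ^ ((d : ℤ) - 2 * (i : ℤ))

/-- The first split sequence φ_i of QRacah type. -/
noncomputable def qφ {K : Type*} [Field K] (d : ℕ) (a b c q : K) (i : ℕ) : K :=
  a⁻¹ * b⁻¹ * q ^ ((d : ℤ) + 1) * (q ^ (i : ℤ) - q ^ (-(i : ℤ))) *
    (q ^ ((i : ℤ) - (d : ℤ) - 1) - q ^ ((d : ℤ) - (i : ℤ) + 1)) *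
    (q ^ (-(i : ℤ)) - a * b * c * q ^ ((i : ℤ) - (d : ℤ) - 1)) *
    (q ^ (-(i : ℤ)) - a * b * c⁻¹ * q ^ ((i : ℤ) - (d : ℤ) - 1))

/-- The second split sequence ϕ_i of QRacah type. -/
noncomputable def qϕ {K : Type*} [Field K] (d : ℕ) (a b c q : K) (i : ℕ) : K :=
  a * b⁻¹ * q ^ ((d : ℤ) + 1) * (q ^ (i : ℤ) - q ^ (-(i : ℤ))) *
    (q ^ ((i : ℤ) - (d : ℤ) - 1) - q ^ ((d : ℤ) - (i : ℤ) + 1)) *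
    (q ^ (-(i : ℤ)) - a⁻¹ * b * c * q ^ ((i : ℤ) - (d : ℤ) - 1)) *
    (q ^ (-(i : ℤ)) - a⁻¹ * b * c⁻¹ * q ^ ((i : ℤ) - (d : ℤ) - 1))

/-- Parameter array over 𝕂 of diameter d: conditions (PA1)–(PA5). -/
def IsParameterArray {K : Type*} [Field K] (d : ℕ) (θ θs φ ϕ : ℕ → K) : Prop :=
  (∀ i, i ≤ d → ∀ j, j ≤ d → i ≠ j → θ i ≠ θ j ∧ θs i ≠ θs j) ∧
  (∀ i, 1 ≤ i → i ≤ d → φ i ≠ 0 ∧ ϕ i ≠ 0) ∧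
  (∀ i, 1 ≤ i → i ≤ d →
    φ i = ϕ 1 * (∑ h ∈ Finset.range i, (θ h - θ (d - h)) / (θ 0 - θ d)) +
      (θs i - θs 0) * (θ (i - 1) - θ d)) ∧
  (∀ i, 1 ≤ i → i ≤ d →
    ϕ i = φ 1 * (∑ h ∈ Finset.range i, (θ h - θ (d - h)) / (θ 0 - θ d)) +
      (θs i - θs 0) * (θ (d - i + 1) - θ 0)) ∧
  (∃ β : K, ∀ i, 2 ≤ i → i + 1 ≤ d →
    (θ (i - 2) - θ (i + 1)) / (θ (i - 1) - θ i) = β ∧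
    (θs (i - 2) - θs (i + 1)) / (θs (i - 1) - θs i) = β)

/-- The set QRAC_red: conditions (RQRAC1)–(RQRAC4). -/
def QRACred {K : Type*} [Field K] (d : ℕ) (a b c q : K) : Prop :=
  (a ≠ 0 ∧ b ≠ 0 ∧ c ≠ 0 ∧ q ≠ 0) ∧
  (∀ i : ℕ, 1 ≤ i → i ≤ d → q ^ (2 * i) ≠ 1) ∧
  (∀ i : ℕ, 1 ≤ i → i ≤ 2 * d - 1 →
    a ^ 2 ≠ q ^ (2 * (d : ℤ) - 2 * (i : ℤ)) ∧ b ^ 2 ≠ q ^ (2 * (d : ℤ) - 2 * (i : ℤ))) ∧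
  (∀ i : ℕ, 1 ≤ i → i ≤ d →
    a * b * c ≠ q ^ ((d : ℤ) - 2 * (i : ℤ) + 1) ∧
    a⁻¹ * b * c ≠ q ^ ((d : ℤ) - 2 * (i : ℤ) + 1) ∧
    a * b⁻¹ * c ≠ q ^ ((d : ℤ) - 2 * (i : ℤ) + 1) ∧
    a * b * c⁻¹ ≠ q ^ ((d : ℤ) - 2 * (i : ℤ) + 1))

/-- The condition on c from Lemma 6.3(i): c is nonzero and the split sequences
are given by the QRacah formulas with parameter c. -/
def SplitCond {K : Type*} [Field K] (d : ℕ) (φ ϕ : ℕ → K) (a b q c : K) : Prop :=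
  c ≠ 0 ∧ ∀ i, 1 ≤ i → i ≤ d → φ i = qφ d a b c q i ∧ ϕ i = qϕ d a b c q i

section QRacah

variable {K : Type*} [Field K] {d : ℕ} {a b c q : K}

theorem qθ_eq (hq : q ≠ 0) (i : ℕ) :
    qθ d a q i = a * ((q ^ i) ^ 2 / q ^ d) + a⁻¹ * (q ^ d / (q ^ i) ^ 2) := by
  simp only [qθ, zpow_sub₀ hq, two_mul, zpow_add₀ hq, zpow_natCast, sq]

theorem qθ_sub_eq (hq : q ≠ 0) {i : ℕ} (hi : i ≤ d) :
    qθ d a q (d - i) = a * (q ^ d / (q ^ i) ^ 2) + a⁻¹ * ((q ^ i) ^ 2 / q ^ d) := by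
  rw [qθ_eq hq, pow_sub₀ q hq hi]
  field_simp

theorem qφ_eq (hq : q ≠ 0) (hc : c ≠ 0) (i : ℕ) :
    qφ d a b c q i = a⁻¹ * b⁻¹ * (q ^ d * q) * (q ^ i - (q ^ i)⁻¹) *
      (q ^ i / (q ^ d * q) - q ^ d * q / q ^ i) *
      (((q ^ i)⁻¹) ^ 2 - a * b * (c + c⁻¹) / (q ^ d * q) +
        (a * b * (q ^ i / (q ^ d * q))) ^ 2) := by
  simp only [qφ, zpow_sub₀ hq, zpow_add₀ hq, zpow_neg, zpow_natCast, zpow_one]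
  field_simp
  ring

theorem qϕ_eq_qφ (i : ℕ) : qϕ d a b c q i = qφ d a⁻¹ b c q i := by
  simp only [qϕ, qφ, inv_inv]

theorem qφ_inv (i : ℕ) : qφ d a b c⁻¹ q i = qφ d a b c q i := by
  simp only [qφ, inv_inv]
  ring

theorem sum_qθ_sub (hq : q ≠ 0) {i : ℕ} (hi : i ≤ d) :
    (q - q⁻¹) * ∑ h ∈ Finset.range i, (qθ d a q h - qθ d a q (d - h)) =
      (a - a⁻¹) * (q ^ i - (q ^ i)⁻¹) * (q ^ i / (q ^ d * q) - q ^ d * q / q ^ i) := by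
  induction i with
  | zero => simp
  | succ n ih =>
    rw [Finset.sum_range_succ, mul_add, ih (by omega), qθ_eq hq, qθ_sub_eq hq (by omega), pow_succ]
    field_simp
    ring

theorem qθ_zero_sub (hq : q ≠ 0) :
    qθ d a q 0 - qθ d a q d = (a - a⁻¹) * ((q ^ d)⁻¹ - q ^ d) := by
  rw [qθ_eq hq, qθ_eq hq]
  field_simp
  ring

/-- The normalized sum occurring in (PA3) and (PA4). -/
theorem sum_qθ_div (hq : q ≠ 0) (hq1 : q - q⁻¹ ≠ 0) (ha1 : a - a⁻¹ ≠ 0) {i : ℕ} (hi : i ≤ d) :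
    ∑ h ∈ Finset.range i, (qθ d a q h - qθ d a q (d - h)) / (qθ d a q 0 - qθ d a q d) =
      (q ^ i - (q ^ i)⁻¹) * (q ^ i / (q ^ d * q) - q ^ d * q / q ^ i) /
        ((q - q⁻¹) * ((q ^ d)⁻¹ - q ^ d)) := by
  rw [← Finset.sum_div, qθ_zero_sub hq, ← mul_div_mul_left _ _ hq1, sum_qθ_sub hq hi,
    mul_assoc (a - a⁻¹), mul_left_comm (q - q⁻¹), mul_div_mul_left _ _ ha1]

/-- The formulas `qφ`, `qϕ` satisfy (PA3). -/
theorem qφ_eq_qϕ_one_mul_add (ha : a ≠ 0) (hb : b ≠ 0) (hc : c ≠ 0) (hq : q ≠ 0)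
    (hq1 : q - q⁻¹ ≠ 0) (hqd : (q ^ d)⁻¹ - q ^ d ≠ 0) {i : ℕ} (hi : 1 ≤ i) :
    qφ d a b c q i = qϕ d a b c q 1 *
      ((q ^ i - (q ^ i)⁻¹) * (q ^ i / (q ^ d * q) - q ^ d * q / q ^ i) /
        ((q - q⁻¹) * ((q ^ d)⁻¹ - q ^ d))) +
      (qθ d b q i - qθ d b q 0) * (qθ d a q (i - 1) - qθ d a q d) := by
  rw [qϕ_eq_qφ, qφ_eq hq hc, qφ_eq hq hc]
  simp only [qθ_eq hq, pow_sub₀ q hq hi, pow_one, pow_zero, inv_inv]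
  have h1 : q / (q ^ d * q) - q ^ d * q / q = (q ^ d)⁻¹ - q ^ d := by field_simp
  rw [h1]
  have hx : q ^ i ≠ 0 := pow_ne_zero _ hq
  have hQ : q ^ d ≠ 0 := pow_ne_zero _ hq
  generalize q ^ i = x at *
  generalize q ^ d = Q at *
  generalize c + c⁻¹ = s
  have key : ∀ A B u v w : K, u ≠ 0 → v ≠ 0 → A * u * v * B * (w / (u * v)) = A * B * w := by
    intro A B u v w hu hv
    field_simp
  rw [key _ _ _ _ _ hq1 hqd]
  field_simp
  ring

/-- The formulas `qφ`, `qϕ` satisfy (PA4). -/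
theorem qϕ_eq_qφ_one_mul_add (ha : a ≠ 0) (hb : b ≠ 0) (hc : c ≠ 0) (hq : q ≠ 0)
    (hq1 : q - q⁻¹ ≠ 0) (hqd : (q ^ d)⁻¹ - q ^ d ≠ 0) {i : ℕ} (hi : 1 ≤ i) (hid : i ≤ d) :
    qϕ d a b c q i = qφ d a b c q 1 *
      ((q ^ i - (q ^ i)⁻¹) * (q ^ i / (q ^ d * q) - q ^ d * q / q ^ i) /
        ((q - q⁻¹) * ((q ^ d)⁻¹ - q ^ d))) +
      (qθ d b q i - qθ d b q 0) * (qθ d a q (d - i + 1) - qθ d a q 0) := by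
  have h := qφ_eq_qϕ_one_mul_add (inv_ne_zero ha) hb hc hq hq1 hqd hi
  have hinv (j : ℕ) (hj : j ≤ d) : qθ d a⁻¹ q j = qθ d a q (d - j) := by
    rw [qθ_eq hq, qθ_sub_eq hq hj, inv_inv, add_comm]
  rw [qϕ_eq_qφ, inv_inv, hinv _ (by omega), hinv _ le_rfl, Nat.sub_self,
    show d - (i - 1) = d - i + 1 by omega] at h
  rw [qϕ_eq_qφ, h]

end QRacah

/-- Corollary 6.4: there exists c satisfying the conditions of Lemma 6.3(i);
moreover if c satisfies them then so does c⁻¹, and no scalar other than c, c⁻¹ does. -/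
theorem stmt_7 {K : Type*} [Field K] [IsAlgClosed K] (d : ℕ) (hd : 3 ≤ d)
    (θ θs φ ϕ : ℕ → K) (hPA : IsParameterArray d θ θs φ ϕ)
    (a b q : K) (ha : a ≠ 0) (hb : b ≠ 0) (hq : q ≠ 0)
    (hq1 : q ^ 2 ≠ 1) (hq2 : q ^ 2 ≠ -1)
    (hθ : ∀ i, i ≤ d → θ i = qθ d a q i)
    (hθs : ∀ i, i ≤ d → θs i = qθ d b q i) :
    (∃ c : K, SplitCond d φ ϕ a b q c) ∧
    ∀ c : K, SplitCond d φ ϕ a b q c →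
      SplitCond d φ ϕ a b q c⁻¹ ∧
      ∀ c' : K, SplitCond d φ ϕ a b q c' → c' = c ∨ c' = c⁻¹ := by
  obtain ⟨hne, -, h3, h4, -⟩ := hPA
  have hd0 := (hne 0 (by omega) d le_rfl (by omega)).1
  rw [hθ 0 (by omega), hθ d le_rfl, ← sub_ne_zero, qθ_zero_sub hq] at hd0
  have ha1 := left_ne_zero_of_mul hd0
  have hqd := right_ne_zero_of_mul hd0
  have hqq : q - q⁻¹ ≠ 0 := by
    intro h
    apply hq1
    field_simp at h
    linear_combination h
  have hQ : q ^ d ≠ 0 := pow_ne_zero _ hq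
  have hsum (i : ℕ) (hi : i ≤ d) :
      ∑ h ∈ Finset.range i, (θ h - θ (d - h)) / (θ 0 - θ d) =
      (q ^ i - (q ^ i)⁻¹) * (q ^ i / (q ^ d * q) - q ^ d * q / q ^ i) /
        ((q - q⁻¹) * ((q ^ d)⁻¹ - q ^ d)) := by
    rw [← sum_qθ_div hq hqq ha1 hi]
    refine Finset.sum_congr rfl fun h hh => ?_
    rw [Finset.mem_range] at hh
    rw [hθ h (by omega), hθ (d - h) (by omega), hθ 0 (by omega), hθ d le_rfl]
  have hsplit (c : K) (hc : c ≠ 0) (h1 : φ 1 = qφ d a b c q 1) : SplitCond d φ ϕ a b q c := by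
    have hϕi (i : ℕ) (hi : 1 ≤ i) (hid : i ≤ d) : ϕ i = qϕ d a b c q i := by
      rw [h4 i hi hid, hsum i hid, qϕ_eq_qφ_one_mul_add ha hb hc hq hqq hqd hi hid, h1,
        hθs i hid, hθs 0 (by omega), hθ _ (by omega), hθ 0 (by omega)]
    refine ⟨hc, fun i hi hid => ⟨?_, hϕi i hi hid⟩⟩
    rw [h3 i hi hid, hsum i hid, qφ_eq_qϕ_one_mul_add ha hb hc hq hqq hqd hi,
      hϕi 1 le_rfl (by omega), hθs i hid, hθs 0 (by omega), hθ _ (by omega), hθ d le_rfl]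
  have hone (c : K) (hc : c ≠ 0) :
      qφ d a b c q 1 = (q - q⁻¹) * ((q ^ d)⁻¹ - q ^ d) *
        (a⁻¹ * b⁻¹ * q ^ d * q⁻¹ + a * b * q * (q ^ d)⁻¹ - (c + c⁻¹)) := by
    rw [qφ_eq hq hc, pow_one, show q / (q ^ d * q) - q ^ d * q / q = (q ^ d)⁻¹ - q ^ d by field_simp]
    generalize q ^ d = Q at *
    generalize c + c⁻¹ = s
    field_simp
    ring
  refine ⟨?_, fun c hc => ⟨⟨inv_ne_zero hc.1, fun i hi hid => ?_⟩, fun c' hc' => ?_⟩⟩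
  · obtain ⟨s, hs⟩ : ∃ s, φ 1 = (q - q⁻¹) * ((q ^ d)⁻¹ - q ^ d) *
        (a⁻¹ * b⁻¹ * q ^ d * q⁻¹ + a * b * q * (q ^ d)⁻¹ - s) :=
      ⟨a⁻¹ * b⁻¹ * q ^ d * q⁻¹ + a * b * q * (q ^ d)⁻¹ -
        φ 1 / ((q - q⁻¹) * ((q ^ d)⁻¹ - q ^ d)), by
          rw [sub_sub_cancel, mul_div_cancel₀ _ (mul_ne_zero hqq hqd)]⟩
    obtain ⟨c, hc⟩ := IsAlgClosed.exists_root
      (Polynomial.C 1 * Polynomial.X ^ 2 + Polynomial.C (-s) * Polynomial.X + Polynomial.C 1 :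
        Polynomial K) (by rw [Polynomial.degree_quadratic one_ne_zero]; decide)
    simp only [Polynomial.IsRoot, Polynomial.eval_add, Polynomial.eval_mul, Polynomial.eval_C,
      Polynomial.eval_pow, Polynomial.eval_X] at hc
    have hc0 : c ≠ 0 := by
      rintro rfl
      simp at hc
    refine ⟨c, hsplit c hc0 ?_⟩
    have hcs : c + c⁻¹ = s := by
      field_simp
      linear_combination hc
    rw [hone c hc0, hcs, hs]
  · rw [qϕ_eq_qφ, qφ_inv, qφ_inv, ← qϕ_eq_qφ]
    exact hc.2 i hi hid
  · have h := (hc'.2 1 le_rfl (by omega)).1.symm.trans (hc.2 1 le_rfl (by omega)).1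
    rw [hone c hc.1, hone c' hc'.1] at h
    have hs := sub_right_injective (mul_left_cancel₀ (mul_ne_zero hqq hqd) h)
    have hc0 := hc.1
    have hc0' := hc'.1
    have hprod : (c' - c) * (c' - c⁻¹) = 0 := by
      have e1 : c * c⁻¹ = 1 := mul_inv_cancel₀ hc0
      have e2 : c' * c'⁻¹ = 1 := mul_inv_cancel₀ hc0'
      linear_combination c' * hs + e1 - e2
    exact (mul_eq_zero.mp hprod).imp sub_eq_zero.mp sub_eq_zero.mp
end

section
/- One has A*·M = M·B*, equivalently M^{−1}·A*·M = B*, where B* ∈ Mat_{d+1}(𝕂) is the upper bidiagonal matrix with B*_{ii} = θ*_i for 0 ≤ i ≤ d, B*_{i−1,i} = φ^ε_i for 1 ≤ i ≤ d, and all other entries 0, where φ^ε_i = b^{−1}c^{−1}q^{d+1}(q^i − q^{−i})(q^{i−d−1} − q^{d−i+1})(q^{−i} − abc·q^{i−d−1})(q^{−i} − a^{−1}bc·q^{i−d−1}). -/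
/-- The lower bidiagonal matrix A with A_{ii} = θ_i and A_{i,i−1} = 1. -/
noncomputable def matA {K : Type*} [Field K] (d : ℕ) (a q : K) :
    Matrix (Fin (d + 1)) (Fin (d + 1)) K :=
  Matrix.of fun i j =>
    if (i : ℕ) = (j : ℕ) then qθ d a q (i : ℕ)
    else if (i : ℕ) = (j : ℕ) + 1 then 1 else 0

/-- The upper bidiagonal matrix A* with A*_{ii} = θ*_i and A*_{i−1,i} = φ_i. -/
noncomputable def matAs {K : Type*} [Field K] (d : ℕ) (a b c q : K) :
    Matrix (Fin (d + 1)) (Fin (d + 1)) K :=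
  Matrix.of fun i j =>
    if (i : ℕ) = (j : ℕ) then qθ d b q (i : ℕ)
    else if (j : ℕ) = (i : ℕ) + 1 then qφ d a b c q (j : ℕ) else 0

/-- A^ε = (q^{−1}·A*A − q·AA*)/(q²−q^{−2})
      + ((a+a^{−1})(b+b^{−1}) + (c+c^{−1})(q^{d+1}+q^{−d−1}))/(q+q^{−1}) · I. -/
noncomputable def matAe {K : Type*} [Field K] (d : ℕ) (a b c q : K) :
    Matrix (Fin (d + 1)) (Fin (d + 1)) K :=
  (q ^ 2 - q ^ (-2 : ℤ))⁻¹ •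
      (q⁻¹ • (matAs d a b c q * matA d a q) - q • (matA d a q * matAs d a b c q)) +
    (((a + a⁻¹) * (b + b⁻¹) + (c + c⁻¹) * (q ^ ((d : ℤ) + 1) + q ^ (-(d : ℤ) - 1))) /
        (q + q⁻¹)) • (1 : Matrix (Fin (d + 1)) (Fin (d + 1)) K)

/-- The q-Pochhammer symbol (x;t)_n = (1−x)(1−xt)⋯(1−x·t^{n−1}). -/
noncomputable def qpoch {K : Type*} [Field K] (x t : K) (n : ℕ) : K :=
  ∏ k ∈ Finset.range n, (1 - x * t ^ k)

/-- The upper triangular matrix M of Definition 12.1. -/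
noncomputable def matM {K : Type*} [Field K] (d : ℕ) (a b c q : K) :
    Matrix (Fin (d + 1)) (Fin (d + 1)) K :=
  Matrix.of fun i j =>
    if (i : ℕ) ≤ (j : ℕ) then
      (-1 : K) ^ (i : ℕ) * b ^ (-(i : ℤ)) * c ^ ((j : ℤ) - (i : ℤ)) *
        q ^ ((i : ℤ) ^ 2 + ((d : ℤ) - 2 * (i : ℤ)) * (j : ℤ)) *
        (qpoch (q ^ (2 * (i : ℤ) + 2)) (q ^ 2) ((j : ℕ) - (i : ℕ)) *
          qpoch (q ^ (2 * (i : ℤ) - 2 * (d : ℤ))) (q ^ 2) ((j : ℕ) - (i : ℕ)) *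
          qpoch (a⁻¹ * b⁻¹ * c⁻¹ * q ^ ((d : ℤ) - 2 * (j : ℤ) + 1)) (q ^ 2)
            ((j : ℕ) - (i : ℕ)) /
          qpoch (q ^ 2) (q ^ 2) ((j : ℕ) - (i : ℕ)))
    else 0

/-- The scalars φ^ε_i of Proposition 13.1. -/
noncomputable def qφε {K : Type*} [Field K] (d : ℕ) (a b c q : K) (i : ℕ) : K :=
  b⁻¹ * c⁻¹ * q ^ ((d : ℤ) + 1) * (q ^ (i : ℤ) - q ^ (-(i : ℤ))) *
    (q ^ ((i : ℤ) - (d : ℤ) - 1) - q ^ ((d : ℤ) - (i : ℤ) + 1)) *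
    (q ^ (-(i : ℤ)) - a * b * c * q ^ ((i : ℤ) - (d : ℤ) - 1)) *
    (q ^ (-(i : ℤ)) - a⁻¹ * b * c * q ^ ((i : ℤ) - (d : ℤ) - 1))

/-- The upper bidiagonal matrix B* with B*_{ii} = θ*_i and B*_{i−1,i} = φ^ε_i. -/
noncomputable def matBs {K : Type*} [Field K] (d : ℕ) (a b c q : K) :
    Matrix (Fin (d + 1)) (Fin (d + 1)) K :=
  Matrix.of fun i j =>
    if (i : ℕ) = (j : ℕ) then qθ d b q (i : ℕ)
    else if (j : ℕ) = (i : ℕ) + 1 then qφε d a b c q (j : ℕ) else 0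

theorem qpoch_succ {K : Type*} [Field K] (x t : K) (n : ℕ) :
    qpoch x t (n + 1) = qpoch x t n * (1 - x * t ^ n) :=
  Finset.prod_range_succ _ _

theorem qpoch_succ' {K : Type*} [Field K] (x t : K) (n : ℕ) :
    qpoch x t (n + 1) = (1 - x) * qpoch (x * t) t n := by
  simp only [qpoch, Finset.prod_range_succ', pow_zero, mul_one]
  rw [mul_comm]
  congr 1
  exact Finset.prod_congr rfl fun k _ => by ring

/-- The entries of `matM`, with natural-number indices. -/
noncomputable def entryM {K : Type*} [Field K] (d : ℕ) (a b c q : K) (i j : ℕ) : K :=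
  if i ≤ j then
    (-1 : K) ^ i * b ^ (-(i : ℤ)) * c ^ ((j : ℤ) - (i : ℤ)) *
      q ^ ((i : ℤ) ^ 2 + ((d : ℤ) - 2 * (i : ℤ)) * (j : ℤ)) *
      (qpoch (q ^ (2 * (i : ℤ) + 2)) (q ^ 2) (j - i) *
        qpoch (q ^ (2 * (i : ℤ) - 2 * (d : ℤ))) (q ^ 2) (j - i) *
        qpoch (a⁻¹ * b⁻¹ * c⁻¹ * q ^ ((d : ℤ) - 2 * (j : ℤ) + 1)) (q ^ 2) (j - i) /
        qpoch (q ^ 2) (q ^ 2) (j - i))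
  else 0

theorem entryM_of_lt {K : Type*} [Field K] (d : ℕ) (a b c q : K) {i j : ℕ} (h : j < i) :
    entryM d a b c q i j = 0 :=
  if_neg (Nat.not_le.mpr h)

theorem entryM_self {K : Type*} [Field K] (d : ℕ) (a b c q : K) (i : ℕ) :
    entryM d a b c q i i = (-1 : K) ^ i * b ^ (-(i : ℤ)) *
      q ^ ((i : ℤ) ^ 2 + ((d : ℤ) - 2 * (i : ℤ)) * (i : ℤ)) := by
  simp [entryM, qpoch]

/-- The `(i, i + n + 1)` entry of `A* M = M B*`, off the diagonal. -/
theorem entryM_recurrence {K : Type*} [Field K] (d : ℕ) {a b c q : K}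
    (ha : a ≠ 0) (hb : b ≠ 0) (hc : c ≠ 0) (hq : q ≠ 0) (i n : ℕ)
    (hn : q ^ (2 * (n + 1)) ≠ 1) :
    qθ d b q i * entryM d a b c q i (i + n + 1) +
        qφ d a b c q (i + 1) * entryM d a b c q (i + 1) (i + n + 1) =
      entryM d a b c q i (i + n + 1) * qθ d b q (i + n + 1) +
        entryM d a b c q i (i + n) * qφε d a b c q (i + n + 1) := by
  have e1 : i + n + 1 - i = n + 1 := by omega
  have e2 : i + n + 1 - (i + 1) = n := by omega
  have e3 : i + n - i = n := by omega
  simp only [entryM, e1, e2, e3, if_pos (show i ≤ i + n + 1 by omega),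
    if_pos (show i + 1 ≤ i + n + 1 by omega), if_pos (show i ≤ i + n by omega)]
  have hU1 := qpoch_succ' (q ^ (2 * (i : ℤ) + 2)) (q ^ 2) n
  have hV1 := qpoch_succ (q ^ (2 * (i : ℤ) + 2)) (q ^ 2) n
  have hU2 := qpoch_succ' (q ^ (2 * (i : ℤ) - 2 * (d : ℤ))) (q ^ 2) n
  have hV2 := qpoch_succ (q ^ (2 * (i : ℤ) - 2 * (d : ℤ))) (q ^ 2) n
  have hU3 := qpoch_succ' (a⁻¹ * b⁻¹ * c⁻¹ *
    q ^ ((d : ℤ) - 2 * ((i + n + 1 : ℕ) : ℤ) + 1)) (q ^ 2) n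
  have hV3 := qpoch_succ (a⁻¹ * b⁻¹ * c⁻¹ *
    q ^ ((d : ℤ) - 2 * ((i + n + 1 : ℕ) : ℤ) + 1)) (q ^ 2) n
  have hD := qpoch_succ (q ^ 2) (q ^ 2) n
  have s1 : q ^ (2 * (i : ℤ) + 2) * q ^ 2 = q ^ (2 * ((i + 1 : ℕ) : ℤ) + 2) := by
    rw [← zpow_natCast, ← zpow_add₀ hq]; congr 1
  have s2 : q ^ (2 * (i : ℤ) - 2 * (d : ℤ)) * q ^ 2 =
      q ^ (2 * ((i + 1 : ℕ) : ℤ) - 2 * (d : ℤ)) := by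
    rw [← zpow_natCast, ← zpow_add₀ hq]; congr 1; push_cast; ring
  have s3 : a⁻¹ * b⁻¹ * c⁻¹ * q ^ ((d : ℤ) - 2 * ((i + n + 1 : ℕ) : ℤ) + 1) * q ^ 2 =
      a⁻¹ * b⁻¹ * c⁻¹ * q ^ ((d : ℤ) - 2 * ((i + n : ℕ) : ℤ) + 1) := by
    rw [mul_assoc, ← zpow_natCast, ← zpow_add₀ hq]; congr 2; push_cast; ring
  rw [s1] at hU1
  rw [s2] at hU2
  rw [s3] at hU3
  generalize qpoch (q ^ (2 * ((i + 1 : ℕ) : ℤ) + 2)) (q ^ 2) n = U1 at *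
  generalize qpoch (q ^ (2 * ((i + 1 : ℕ) : ℤ) - 2 * (d : ℤ))) (q ^ 2) n = U2 at *
  generalize qpoch (a⁻¹ * b⁻¹ * c⁻¹ *
    q ^ ((d : ℤ) - 2 * ((i + n : ℕ) : ℤ) + 1)) (q ^ 2) n = U3 at *
  generalize qpoch (q ^ (2 * (i : ℤ) + 2)) (q ^ 2) n = V1 at *
  generalize qpoch (q ^ (2 * (i : ℤ) - 2 * (d : ℤ))) (q ^ 2) n = V2 at *
  generalize qpoch (a⁻¹ * b⁻¹ * c⁻¹ *
    q ^ ((d : ℤ) - 2 * ((i + n + 1 : ℕ) : ℤ) + 1)) (q ^ 2) n = V3 at *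
  generalize qpoch (q ^ (2 * (i : ℤ) + 2)) (q ^ 2) (n + 1) = P1 at *
  generalize qpoch (q ^ (2 * (i : ℤ) - 2 * (d : ℤ))) (q ^ 2) (n + 1) = P2 at *
  generalize qpoch (a⁻¹ * b⁻¹ * c⁻¹ *
    q ^ ((d : ℤ) - 2 * ((i + n + 1 : ℕ) : ℤ) + 1)) (q ^ 2) (n + 1) = P3 at *
  rw [hD]
  generalize qpoch (q ^ 2) (q ^ 2) n = W at *
  clear hD s1 s2 s3 e1 e2 e3
  have hE2 : q ^ (((i + 1 : ℕ) : ℤ) ^ 2 +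
      ((d : ℤ) - 2 * ((i + 1 : ℕ) : ℤ)) * ((i + n + 1 : ℕ) : ℤ)) =
      q ^ ((i : ℤ) ^ 2 + ((d : ℤ) - 2 * (i : ℤ)) * ((i + n + 1 : ℕ) : ℤ)) *
        q ^ (-2 * (n : ℤ) - 1) := by
    rw [← zpow_add₀ hq]; congr 1; push_cast; ring
  have hE3 : q ^ ((i : ℤ) ^ 2 + ((d : ℤ) - 2 * (i : ℤ)) * ((i + n : ℕ) : ℤ)) =
      q ^ ((i : ℤ) ^ 2 + ((d : ℤ) - 2 * (i : ℤ)) * ((i + n + 1 : ℕ) : ℤ)) *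
        q ^ (2 * (i : ℤ) - (d : ℤ)) := by
    rw [← zpow_add₀ hq]; congr 1; push_cast; ring
  rw [hE2, hE3]
  clear hE2 hE3
  generalize q ^ ((i : ℤ) ^ 2 + ((d : ℤ) - 2 * (i : ℤ)) * ((i + n + 1 : ℕ) : ℤ)) = E
  have hc1 : c ^ (((i + n + 1 : ℕ) : ℤ) - (i : ℤ)) = c ^ n * c := by
    rw [← pow_succ, ← zpow_natCast]; congr 1; push_cast; ring
  have hc2 : c ^ (((i + n + 1 : ℕ) : ℤ) - ((i + 1 : ℕ) : ℤ)) = c ^ n := by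
    rw [← zpow_natCast]; congr 1; push_cast; ring
  have hc3 : c ^ (((i + n : ℕ) : ℤ) - (i : ℤ)) = c ^ n := by
    rw [← zpow_natCast]; congr 1; push_cast; ring
  have hb1 : b ^ (-((i + 1 : ℕ) : ℤ)) = b ^ (-(i : ℤ)) * b⁻¹ := by
    rw [← zpow_neg_one, ← zpow_add₀ hb]; congr 1; push_cast; ring
  rw [hc1, hc2, hc3, hb1, pow_succ (-1 : K) i]
  clear hc1 hc2 hc3 hb1
  generalize (-1 : K) ^ i = S
  generalize b ^ (-(i : ℤ)) = B
  generalize c ^ n = C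
  have hn' : 1 - q ^ 2 * (q ^ 2) ^ n ≠ 0 := by
    intro h0
    apply hn
    rw [pow_mul, pow_succ']
    exact (sub_eq_zero.mp h0).symm
  have hz : ∀ m : ℕ, q ^ m ≠ 0 := fun m => pow_ne_zero m hq
  have hqi := hz i
  have hqn := hz n
  have hqd := hz d
  clear hz hn
  have key2 : qφ d a b c q (i + 1) * (U1 * U2 * V3) =
      -(c * q ^ d / q ^ i) * (1 / (q * q ^ i) - a * b * c⁻¹ * q ^ i / q ^ d) *
        (P1 * P2 * P3) := by
    rw [hU1, hU2, hV3]
    simp only [qφ, ← pow_mul, Nat.cast_add, Nat.cast_one, two_mul, zpow_add₀ hq, zpow_sub₀ hq,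
      zpow_neg, zpow_natCast, pow_add, zpow_ofNat]
    field_simp
    ring
  have key3 : qφε d a b c q (i + n + 1) * (V1 * V2 * U3) =
      -(a * q ^ d / (q ^ i * q ^ n)) *
        (1 / (q * q ^ i * q ^ n) - a⁻¹ * b * c * (q ^ i * q ^ n) / q ^ d) *
        (P1 * P2 * P3) := by
    rw [hV1, hV2, hU3]
    simp only [qφε, ← pow_mul, Nat.cast_add, Nat.cast_one, two_mul, zpow_add₀ hq, zpow_sub₀ hq,
      zpow_neg, zpow_natCast, pow_add, zpow_ofNat]
    field_simp
    ring
  clear hU1 hV1 hU2 hV2 hU3 hV3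
  have key1 : qθ d b q i - qθ d b q (i + n + 1) =
      (b * (q ^ i) ^ 2 / q ^ d - b⁻¹ * q ^ d / ((q ^ i) ^ 2 * (q ^ n) ^ 2 * q ^ 2)) *
        (1 - q ^ 2 * (q ^ 2) ^ n) := by
    simp only [qθ, ← pow_mul, Nat.cast_add, Nat.cast_one, two_mul, zpow_add₀ hq, zpow_sub₀ hq,
      zpow_natCast, zpow_one, pow_add]
    field_simp
    ring
  have hx2 : q ^ (-2 * (n : ℤ) - 1) = 1 / ((q ^ n) ^ 2 * q) := by
    rw [show -2 * (n : ℤ) - 1 = -((n : ℤ) + n + 1) by ring]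
    simp only [zpow_neg, zpow_add₀ hq, zpow_natCast, zpow_one]
    field_simp
  have hx3 : q ^ (2 * (i : ℤ) - (d : ℤ)) = (q ^ i) ^ 2 / q ^ d := by
    simp only [two_mul, zpow_sub₀ hq, zpow_add₀ hq, zpow_natCast]
    ring
  rw [hx2, hx3]
  have hcoeff : (b * (q ^ i) ^ 2 / q ^ d - b⁻¹ * q ^ d / ((q ^ i) ^ 2 * (q ^ n) ^ 2 * q ^ 2)) * c +
      b⁻¹ / ((q ^ n) ^ 2 * q) *
        ((c * q ^ d / q ^ i) * (1 / (q * q ^ i) - a * b * c⁻¹ * q ^ i / q ^ d)) =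
      (q ^ i) ^ 2 / q ^ d * (-(a * q ^ d / (q ^ i * q ^ n)) *
        (1 / (q * q ^ i * q ^ n) - a⁻¹ * b * c * (q ^ i * q ^ n) / q ^ d)) := by
    field_simp
    ring
  rw [← sub_eq_zero]
  by_cases hW : W = 0
  · simp [hW]
  generalize qθ d b q i = t1 at *
  generalize qθ d b q (i + n + 1) = t2 at *
  generalize qφ d a b c q (i + 1) = f2 at *
  generalize qφε d a b c q (i + n + 1) = f3 at *
  generalize 1 - q ^ 2 * (q ^ 2) ^ n = R at *
  have hRW : P1 * P2 * P3 / (W * R) * R = P1 * P2 * P3 / W := by field_simp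
  linear_combination (S * B * C * c * E * (P1 * P2 * P3 / (W * R))) * key1 +
    (S * B * C * E) * (b⁻¹ * (-1) * (1 / ((q ^ n) ^ 2 * q)) / W) * key2 -
    (S * B * C * E * ((q ^ i) ^ 2 / q ^ d) / W) * key3 +
    (S * B * C * E * (P1 * P2 * P3 / W)) * hcoeff +
    (S * B * C * E * c * (b * (q ^ i) ^ 2 / q ^ d -
      b⁻¹ * q ^ d / ((q ^ i) ^ 2 * (q ^ n) ^ 2 * q ^ 2))) * hRW

theorem matAs_mul_matM {K : Type*} [Field K] (d : ℕ) {a b c q : K} (h : QRACred d a b c q) :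
    matAs d a b c q * matM d a b c q = matM d a b c q * matBs d a b c q := by
  obtain ⟨⟨ha, hb, hc, hq⟩, hq2, -, -⟩ := h
  ext ⟨i, hi⟩ ⟨j, hj⟩
  rw [Matrix.mul_apply, Matrix.mul_apply]
  have hl : ∑ k : Fin (d + 1), matAs d a b c q ⟨i, hi⟩ k * matM d a b c q k ⟨j, hj⟩ =
      qθ d b q i * entryM d a b c q i j +
        qφ d a b c q (i + 1) * entryM d a b c q (i + 1) j := by
    calc _ = ∑ m ∈ Finset.range (d + 1), (
            (if i = m then qθ d b q i * entryM d a b c q m j else 0) +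
            (if i + 1 = m then qφ d a b c q m * entryM d a b c q m j else 0)) := by
          rw [Finset.sum_range]
          refine Finset.sum_congr rfl fun k _ => ?_
          change (if i = (k : ℕ) then qθ d b q i else
            if (k : ℕ) = i + 1 then qφ d a b c q k else 0) * entryM d a b c q k j = _
          grind
      _ = _ := by
          rw [Finset.sum_add_distrib, Finset.sum_ite_eq,
            Finset.sum_ite_eq, if_pos (Finset.mem_range.mpr hi)]
          congr 1
          split_ifs with h1
          · rfl
          · rw [Finset.mem_range] at h1
            rw [entryM_of_lt _ _ _ _ _ (by omega), mul_zero]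
  have hr : ∑ k : Fin (d + 1), matM d a b c q ⟨i, hi⟩ k * matBs d a b c q k ⟨j, hj⟩ =
      entryM d a b c q i j * qθ d b q j +
        if j = 0 then 0 else entryM d a b c q i (j - 1) * qφε d a b c q j := by
    calc _ = ∑ m ∈ Finset.range (d + 1), (
            (if m = j then entryM d a b c q i m * qθ d b q m else 0) +
            (if m = j - 1 then
              if j = 0 then 0 else entryM d a b c q i m * qφε d a b c q j else 0)) := by
          rw [Finset.sum_range]
          refine Finset.sum_congr rfl fun k _ => ?_
          change entryM d a b c q i k * (if (k : ℕ) = j then qθ d b q k else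
            if j = (k : ℕ) + 1 then qφε d a b c q j else 0) = _
          grind
      _ = _ := by
          rw [Finset.sum_add_distrib, Finset.sum_ite_eq',
            Finset.sum_ite_eq', if_pos (Finset.mem_range.mpr hj),
            if_pos (Finset.mem_range.mpr (by omega))]
  rw [hl, hr]
  rcases lt_trichotomy i j with hij | rfl | hij
  · obtain ⟨n, rfl⟩ := Nat.exists_eq_add_of_lt hij
    rw [if_neg (Nat.succ_ne_zero _), Nat.add_sub_cancel]
    exact entryM_recurrence d ha hb hc hq i n (hq2 (n + 1) (by omega) (by omega))
  · rw [entryM_of_lt d a b c q (Nat.lt_succ_self i), mul_zero, add_zero]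
    split_ifs with h0
    · ring
    · rw [entryM_of_lt d a b c q (by omega : i - 1 < i)]
      ring
  · rw [entryM_of_lt d a b c q hij, entryM_of_lt d a b c q (by omega : j < i + 1),
      entryM_of_lt d a b c q (by omega : j - 1 < i)]
    simp

theorem isUnit_det_matM {K : Type*} [Field K] (d : ℕ) (a : K) {b q : K} (c : K)
    (hb : b ≠ 0) (hq : q ≠ 0) : IsUnit (matM d a b c q).det := by
  have hM : ∀ i j : Fin (d + 1), matM d a b c q i j = entryM d a b c q i j := fun _ _ => rfl
  have ht : (matM d a b c q).IsUpperTriangular := fun i j hij => by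
    rw [hM]
    exact entryM_of_lt d a b c q hij
  rw [Matrix.det_of_isUpperTriangular ht, isUnit_iff_ne_zero]
  refine Finset.prod_ne_zero_iff.mpr fun i _ => ?_
  rw [hM, entryM_self]
  exact mul_ne_zero (mul_ne_zero (pow_ne_zero _ (neg_ne_zero.mpr one_ne_zero))
    (zpow_ne_zero _ hb)) (zpow_ne_zero _ hq)

/-- Proposition 13.1: A*·M = M·B*, equivalently M^{−1}·A*·M = B*. -/
theorem stmt_12 {K : Type*} [Field K] [IsAlgClosed K] (d : ℕ) (hd : 3 ≤ d)
    (a b c q : K) (h : QRACred d a b c q) :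
    matAs d a b c q * matM d a b c q = matM d a b c q * matBs d a b c q ∧
    (matM d a b c q)⁻¹ * matAs d a b c q * matM d a b c q = matBs d a b c q := by
  have hmul := matAs_mul_matM d h
  refine ⟨hmul, ?_⟩
  rw [Matrix.mul_assoc, hmul,
    Matrix.nonsing_inv_mul_cancel_left _ _ (isUnit_det_matM d a c h.1.2.1 h.1.2.2.2)]
end
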